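/- Let q ≥ 1 be an integer and let φ₁*, φ₂* be as in the context. Then ⟨φ₁*, φ₁*⟩ = ⟨φ₂*, φ₂*⟩ = 1/(q(q+2)), where ⟨f,g⟩ = ∫₀¹ f(x)g(x) dx. -/

import Mathlib

open Polynomial

/-- The Jacobi-type polynomial sequence: G 1 = 1, G 2 = X - 1/2, and for k ≥ 3,
    G k = (X - 1/2)·G (k-1) - ((k-2)(k+2)/(4(2k-1)(2k+1)))·G (k-2). -/
noncomputable def G : ℕ → Polynomial ℝ
  | 0 => 0
  | 1 => 1
  | 2 => Polynomial.X - Polynomial.C (1/2)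
  | (k+3) =>
      (Polynomial.X - Polynomial.C (1/2)) * G (k+2)
        - Polynomial.C ((((k:ℝ)+1)*((k:ℝ)+5))/(4*(2*(k:ℝ)+5)*(2*(k:ℝ)+7))) * G (k+1)

/-- ψ_k = ((2k+2)!/((k−1)!·(k+1)!))·X(1−X)·G_k. -/
noncomputable def psi (k : ℕ) : Polynomial ℝ :=
  Polynomial.C ((Nat.factorial (2*k+2) : ℝ) /
      ((Nat.factorial (k-1) : ℝ) * (Nat.factorial (k+1) : ℝ)))
    * (Polynomial.X * (1 - Polynomial.X)) * G k

/-- φ₁* = X − ∑_{k=1}^{q−1} ((2k+3)/(k(k+1)(k+2)(k+3)))·ψ_k. -/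
noncomputable def phiStar1 (q : ℕ) : Polynomial ℝ :=
  Polynomial.X - ∑ k ∈ Finset.Icc 1 (q-1),
    Polynomial.C ((2*(k:ℝ)+3)/((k:ℝ)*((k:ℝ)+1)*((k:ℝ)+2)*((k:ℝ)+3))) * psi k

/-- φ₂* = (1−X) − ∑_{k=1}^{q−1} ((−1)^{k−1}(2k+3)/(k(k+1)(k+2)(k+3)))·ψ_k. -/
noncomputable def phiStar2 (q : ℕ) : Polynomial ℝ :=
  (1 - Polynomial.X) - ∑ k ∈ Finset.Icc 1 (q-1),
    Polynomial.C ((-1:ℝ)^(k-1) * (2*(k:ℝ)+3)/((k:ℝ)*((k:ℝ)+1)*((k:ℝ)+2)*((k:ℝ)+3))) * psi k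

noncomputable def cc (k : ℕ) : ℝ := (k:ℝ)*((k:ℝ)+4)/(4*(2*(k:ℝ)+3)*(2*(k:ℝ)+5))

theorem G_rec (k : ℕ) : G (k+2) = (X - C (1/2)) * G (k+1) - C (cc k) * G k := by
  cases k with
  | zero => simp [G]
  | succ n =>
    rw [G]
    unfold cc
    push_cast
    congr 3
    ring_nf

theorem g_rec (k : ℕ) (x : ℝ) :
    (G (k+2)).eval x = (x - 1/2) * (G (k+1)).eval x - cc k * (G k).eval x := by
  rw [G_rec]; simp

theorem d_rec (k : ℕ) (x : ℝ) :
    (derivative (G (k+2))).eval x = (G (k+1)).eval x + (x - 1/2) * (derivative (G (k+1))).eval x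
      - cc k * (derivative (G k)).eval x := by
  rw [G_rec]; simp

theorem struct_rel (k : ℕ) : ∀ x : ℝ,
    x*(1-x) * (derivative (G (k+1))).eval x
      = -(k:ℝ)*(x-1/2)*(G (k+1)).eval x + (2*(k:ℝ)+5) * cc k * (G k).eval x ∧
    (k:ℝ) * (x*(1-x) * (derivative (G k)).eval x)
      = (k:ℝ) * (((k:ℝ)+4)*(x-1/2)*(G k).eval x - (2*(k:ℝ)+3) * (G (k+1)).eval x) := by
  induction k with
  | zero => intro x; simp [G]
  | succ k ih =>
    intro x
    obtain ⟨h1, h2⟩ := ih x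
    have hg := g_rec k x
    have hd := d_rec k x
    have hB : x*(1-x) * (derivative (G (k+1))).eval x =
        ((k:ℝ)+5)*(x-1/2)*(G (k+1)).eval x - (2*(k:ℝ)+5) * (G (k+2)).eval x := by
      rw [h1, hg]; ring
    have hcc : cc k * (x*(1-x) * (derivative (G k)).eval x) = cc k *
        (((k:ℝ)+4)*(x-1/2)*(G k).eval x - (2*(k:ℝ)+3) * (G (k+1)).eval x) := by
      unfold cc
      linear_combination ((k:ℝ)+4)/(4*(2*(k:ℝ)+3)*(2*(k:ℝ)+5)) * h2
    have hk1 : (2*(k:ℝ)+3) ≠ 0 := by positivity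
    have hk2 : (2*(k:ℝ)+5) ≠ 0 := by positivity
    have hk3 : (2*(k:ℝ)+7) ≠ 0 := by positivity
    have e1 : (2*(k:ℝ)+3) * cc k = (k:ℝ)*((k:ℝ)+4)/(4*(2*(k:ℝ)+5)) := by
      unfold cc; field_simp
    have e2 : (2*((k:ℝ)+1)+5) * cc (k+1) = ((k:ℝ)+1)*((k:ℝ)+5)/(4*(2*(k:ℝ)+5)) := by
      unfold cc; push_cast
      have : 2*((k:ℝ)+1)+5 ≠ 0 := by positivity
      have : 2*((k:ℝ)+1)+3 ≠ 0 := by positivity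
      field_simp; ring
    push_cast
    refine ⟨?_, ?_⟩
    · rw [e2]
      have e5 : ((k:ℝ)+1)*((k:ℝ)+5)/(4*(2*(k:ℝ)+5)) = 1/4 + (2*(k:ℝ)+3) * cc k := by
        rw [e1]; field_simp; ring
      rw [e5, hd, hg]
      linear_combination (x - 1/2) * h1 - hcc
    · rw [hB]; ring

theorem ode (k : ℕ) : ∀ x : ℝ,
    x*(1-x) * (derivative (derivative (G (k+1)))).eval x
      = 6*(x-1/2) * (derivative (G (k+1))).eval x - (k:ℝ)*((k:ℝ)+5) * (G (k+1)).eval x := by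
  have hp : X*(1-X) * derivative (G (k+1))
      = C (-(k:ℝ))*(X-C (1/2))*G (k+1) + C ((2*(k:ℝ)+5) * cc k) * G k := by
    apply Polynomial.funext; intro x
    simpa using (struct_rel k x).1
  have hd := congrArg derivative hp
  have key : (X*(1-X) : ℝ[X]) * (X*(1-X) * derivative (derivative (G (k+1)))
      - (C 6*(X-C (1/2)) * derivative (G (k+1)) - C ((k:ℝ)*((k:ℝ)+5)) * G (k+1))) = 0 := by
    apply Polynomial.funext; intro x
    have hdx := congrArg (eval x) hd
    obtain ⟨h1, h2⟩ := struct_rel k x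
    have hk1 : (2*(k:ℝ)+3) ≠ 0 := by positivity
    have hk2 : (2*(k:ℝ)+5) ≠ 0 := by positivity
    have hcc : (2*(k:ℝ)+5) * cc k * (x*(1-x) * (derivative (G k)).eval x) = (2*(k:ℝ)+5) * cc k *
        (((k:ℝ)+4)*(x-1/2)*(G k).eval x) - (k:ℝ)*(k+4)/4 * (G (k+1)).eval x := by
      have e : (2*(k:ℝ)+5) * cc k = (k:ℝ)*((k:ℝ)+4)/(4*(2*(k:ℝ)+3)) := by unfold cc; field_simp
      have e' : (k:ℝ)*(k+4)/4 = (k:ℝ)*(k+4)/(4*(2*(k:ℝ)+3)) * (2*k+3) := by field_simp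
      rw [e, e']
      linear_combination ((k:ℝ)+4)/(4*(2*(k:ℝ)+3)) * h2
    simp at hdx
    simp only [eval_mul, eval_sub, eval_X, eval_one, eval_C, eval_zero]
    linear_combination x*(1-x)*hdx + hcc - ((k:ℝ)+4)*(x-1/2) * h1
  have hW : (X*(1-X) : ℝ[X]) ≠ 0 := by
    intro h
    have := congrArg (eval (1/2:ℝ)) h
    norm_num at this
  have h0 := (mul_eq_zero.mp key).resolve_left hW
  intro x
  have := congrArg (eval x) h0
  simp at this
  linear_combination this

theorem ftc (F : ℝ[X]) : ∫ x in (0:ℝ)..1, (derivative F).eval x = F.eval 1 - F.eval 0 := by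
  apply intervalIntegral.integral_eq_sub_of_hasDerivAt (f := fun x => F.eval x)
  · intro x _; exact F.hasDerivAt x
  · exact (Polynomial.continuous _).intervalIntegrable _ _

theorem orth (k m : ℕ) (h : k ≠ m) :
    ∫ x in (0:ℝ)..1, (x*(1-x))^2 * ((G (k+1)).eval x * (G (m+1)).eval x) = 0 := by
  have hne : (m:ℝ)*(m+5) - k*(k+5) ≠ 0 := by
    have : (m:ℝ)*(m+5) - k*(k+5) = (m-k)*(m+k+5) := by ring
    rw [this]
    apply mul_ne_zero
    · rw [sub_ne_zero]; exact_mod_cast h.symm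
    · positivity
  have := ftc ((X*(1-X))^3 * (derivative (G (k+1)) * G (m+1) - G (k+1) * derivative (G (m+1))))
  have e : ∀ x : ℝ, (derivative ((X*(1-X))^3 * (derivative (G (k+1)) * G (m+1) - G (k+1) * derivative (G (m+1))))).eval x
     = ((m:ℝ)*(m+5) - k*(k+5)) * ((x*(1-x))^2 * ((G (k+1)).eval x * (G (m+1)).eval x)) := by
    intro x
    have h1 := ode k x
    have h2 := ode m x
    simp [derivative_pow]
    linear_combination (x*(1-x))^2 * ((G (m+1)).eval x * h1 - (G (k+1)).eval x * h2)
  simp_rw [e] at this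
  rw [intervalIntegral.integral_const_mul] at this
  simp at this
  rcases this with h | h
  · exact absurd h hne
  · simpa using h

noncomputable def hh (k : ℕ) : ℝ := ∫ x in (0:ℝ)..1, (x*(1-x))^2 * ((G (k+1)).eval x * (G (k+1)).eval x)

theorem hh_succ (k : ℕ) : hh (k+1) = cc (k+1) * hh k := by
  have o1 := orth (k+2) k (by omega)
  have hz : cc k * (∫ x in (0:ℝ)..1, (x*(1-x))^2 * ((G (k+2)).eval x * (G k).eval x)) = 0 := by
    cases k with
    | zero => simp [cc]
    | succ n => rw [orth (n+2) n (by omega)]; simp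
  have : hh (k+1) = (∫ x in (0:ℝ)..1, (x*(1-x))^2 * ((G (k+2+1)).eval x * (G (k+1)).eval x))
      - cc k * (∫ x in (0:ℝ)..1, (x*(1-x))^2 * ((G (k+2)).eval x * (G k).eval x)) + cc (k+1) * hh k := by
    unfold hh
    rw [← intervalIntegral.integral_const_mul, ← intervalIntegral.integral_const_mul,
      ← intervalIntegral.integral_sub, ← intervalIntegral.integral_add]
    · congr 1; ext x
      have h1 := g_rec k x
      have h2 := g_rec (k+1) x
      have : G (k+1+1) = G (k+2) := rfl
      have : G (k+2+1) = G (k+1+2) := rfl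
      simp only [*]
      ring
    all_goals apply Continuous.intervalIntegrable; fun_prop
  rw [this, o1, hz]; ring

theorem hh_zero : hh 0 = 1/30 := by
  have := ftc (C (1/3) * X^3 - C (1/2) * X^4 + C (1/5) * X^5)
  unfold hh
  rw [show (1/30:ℝ) = (C (1/3) * X^3 - C (1/2) * X^4 + C (1/5) * X^5 : ℝ[X]).eval 1 - (C (1/3) * X^3 - C (1/2) * X^4 + C (1/5) * X^5 : ℝ[X]).eval 0 by norm_num, ← this]
  congr 1; ext x
  simp [G, derivative_pow]
  ring

noncomputable def nu (k : ℕ) : ℝ := (Nat.factorial (2*k+2) : ℝ) /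
      ((Nat.factorial (k-1) : ℝ) * (Nat.factorial (k+1) : ℝ))

theorem nu_succ (k : ℕ) : nu (k+2) = nu (k+1) * (2*(2*k+5)*(k+3)/((k+1)*(k+3))) := by
  unfold nu
  have : 2*(k+2)+2 = (2*(k+1)+2)+1+1 := by ring
  rw [this, Nat.factorial_succ, Nat.factorial_succ]
  have : k+2-1 = k+1 := rfl
  rw [this, Nat.factorial_succ k, Nat.factorial_succ (k+2)]
  have : k+1-1 = k := rfl
  rw [this]
  have := Nat.factorial_pos k
  have := Nat.factorial_pos (k+2)
  push_cast
  field_simp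
  ring

theorem nu_one : nu 1 = 12 := by norm_num [nu, Nat.factorial]

theorem g_one (k : ℕ) : (G (k+2)).eval 1 = ((k:ℝ)+5)/(2*(2*k+5)) * (G (k+1)).eval 1 := by
  have h := (struct_rel (k+1) 1).1
  have : 2*((k:ℝ)+1)+5 ≠ 0 := by positivity
  have : 2*((k:ℝ)+1)+3 ≠ 0 := by positivity
  unfold cc at h
  push_cast at h
  have hk : (k:ℝ)+1 ≠ 0 := by positivity
  have h' : ((k:ℝ)+1) * ((G (k+2)).eval 1 - ((k:ℝ)+5)/(2*(2*k+5)) * (G (k+1)).eval 1) = 0 := by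
    field_simp at h ⊢
    linear_combination (1/2)*h
  linear_combination (mul_eq_zero.mp h').resolve_left hk

theorem nu_g (k : ℕ) : nu (k+1) * (G (k+1)).eval 1 = ((k:ℝ)+1)*(k+2)*(k+3)*(k+4)/2 := by
  induction k with
  | zero => norm_num [nu_one, G]
  | succ k ih =>
    rw [nu_succ, g_one]
    have : (G (k+1)).eval 1 * nu (k+1) = ((k:ℝ)+1)*(k+2)*(k+3)*(k+4)/2 := by rw [mul_comm, ih]
    push_cast
    have e : nu (k + 1) * (2 * (2 * (k:ℝ) + 5) * (k + 3) / ((k + 1) * (k + 3))) * ((k + 5) / (2 * (2 * k + 5)) * eval 1 (G (k + 1)))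
      = (nu (k+1) * (G (k+1)).eval 1) * ((k+5)/(k+1)) := by field_simp
    rw [e, ih]; field_simp; ring

theorem nu_hh (k : ℕ) : nu (k+1)^2 * hh k = ((k:ℝ)+1)*(k+2)*(k+3)*(k+4)/(2*k+5) := by
  induction k with
  | zero => norm_num [nu_one, hh_zero]
  | succ k ih =>
    rw [nu_succ, hh_succ]
    have e : (nu (k + 1) * (2 * (2 * (k:ℝ) + 5) * (k + 3) / ((k + 1) * (k + 3))))^2 * (cc (k+1) * hh k)
      = (nu (k+1)^2 * hh k) * ((2 * (2 * (k:ℝ) + 5) / (k + 1))^2 * cc (k+1)) := by field_simp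
    rw [e, ih]
    unfold cc
    push_cast
    have : 2*((k:ℝ)+1)+5 ≠ 0 := by positivity
    have : 2*((k:ℝ)+1)+3 ≠ 0 := by positivity
    field_simp; ring

theorem moment (k : ℕ) : ∫ x in (0:ℝ)..1, x * (x*(1-x) * (G (k+1)).eval x)
    = 2 * (G (k+1)).eval 1 / (((k:ℝ)+1)*(k+2)*(k+3)*(k+4)) := by
  set Q : ℝ[X] := C (-1/(((k:ℝ)+1)*(k+4))) * (X*(1-X)*derivative (G (k+1)) + C 2 * (1 - C 2*X) * G (k+1)) with hQ
  set R : ℝ[X] := C (-1/(((k:ℝ)+2)*(k+3))) * (X*(1-X)*G (k+1) + (1 - C 2*X) * Q) with hR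
  have dQ : ∀ x, (derivative Q).eval x = (G (k+1)).eval x := by
    intro x
    have := ode k x
    simp [hQ]
    field_simp
    linear_combination -this
  have eQ : ∀ x, Q.eval x = -1/(((k:ℝ)+1)*(k+4)) * (x*(1-x)*(derivative (G (k+1))).eval x + 2 * (1 - 2*x) * (G (k+1)).eval x) := by
    intro x; simp [hQ]
  have eR : ∀ x, R.eval x = -1/(((k:ℝ)+2)*(k+3)) * (x*(1-x)*(G (k+1)).eval x + (1 - 2*x) * Q.eval x) := by
    intro x; simp [hR]
  have dR : ∀ x, (derivative R).eval x = Q.eval x := by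
    intro x
    have h1 := eQ x
    have h2 := dQ x
    clear_value Q
    simp [hR]
    rw [h2]
    field_simp at h1 ⊢
    linear_combination -h1
  have := ftc (X*(X*(1-X))*Q - (C 2*X - C 3*X^2)*R - C (1/(((k:ℝ)+2)*(k+3))) * ((C 2 - C 6 * X)*(X*(1-X))*Q)
     + C (6/(((k:ℝ)+1)*(k+2)*(k+3)*(k+4))) * ((X*(1-X))^2 * G (k+1)))
  have r1 : R.eval 1 = 2 * (G (k+1)).eval 1 / (((k:ℝ)+1)*(k+2)*(k+3)*(k+4)) := by
    rw [eR, eQ]; field_simp; ring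
  clear_value R Q
  simp only [eval_add, eval_sub, eval_mul, eval_C, eval_X, eval_pow, eval_one] at this
  rw [r1] at this
  convert this using 1
  · congr 1; ext x
    have h1 := eQ x
    have h2 := eR x
    have h3 := dQ x
    have h4 := dR x
    simp [derivative_pow, h3, h4, h2]
    field_simp at h1 ⊢
    linear_combination (-6*x*(1-x)) * h1
  · ring

theorem psi_eval (k : ℕ) (x : ℝ) : (psi k).eval x = nu k * (x*(1-x)) * (G k).eval x := by
  simp [psi, nu]

theorem psi_orth (k m : ℕ) (h : k ≠ m) :
    ∫ x in (0:ℝ)..1, (psi (k+1)).eval x * (psi (m+1)).eval x = 0 := by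
  have e : ∀ x : ℝ, (psi (k+1)).eval x * (psi (m+1)).eval x
      = (nu (k+1) * nu (m+1)) * ((x*(1-x))^2 * ((G (k+1)).eval x * (G (m+1)).eval x)) := by
    intro x; rw [psi_eval, psi_eval]; ring
  simp_rw [e]
  rw [intervalIntegral.integral_const_mul, orth k m h, mul_zero]

theorem psi_norm (k : ℕ) :
    ∫ x in (0:ℝ)..1, (psi (k+1)).eval x * (psi (k+1)).eval x
      = ((k:ℝ)+1)*(k+2)*(k+3)*(k+4)/(2*k+5) := by
  have e : ∀ x : ℝ, (psi (k+1)).eval x * (psi (k+1)).eval x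
      = (nu (k+1))^2 * ((x*(1-x))^2 * ((G (k+1)).eval x * (G (k+1)).eval x)) := by
    intro x; rw [psi_eval]; ring
  simp_rw [e]
  rw [intervalIntegral.integral_const_mul, ← nu_hh]; rfl

theorem psi_X (k : ℕ) : ∫ x in (0:ℝ)..1, x * (psi (k+1)).eval x = 1 := by
  have e : ∀ x : ℝ, x * (psi (k+1)).eval x
      = nu (k+1) * (x * (x*(1-x) * (G (k+1)).eval x)) := by
    intro x; rw [psi_eval]; ring
  simp_rw [e]
  rw [intervalIntegral.integral_const_mul, moment]
  have := nu_g k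
  have e2 : nu (k+1) * (2 * (G (k+1)).eval 1 / (((k:ℝ)+1)*(k+2)*(k+3)*(k+4)))
    = 2 * (nu (k+1) * (G (k+1)).eval 1) / (((k:ℝ)+1)*(k+2)*(k+3)*(k+4)) := by ring
  rw [e2, this]; field_simp

theorem phi_succ (q : ℕ) (x : ℝ) : (phiStar1 (q+2)).eval x = (phiStar1 (q+1)).eval x
    - (2*(q:ℝ)+5)/(((q:ℝ)+1)*(q+2)*(q+3)*(q+4)) * (psi (q+1)).eval x := by
  unfold phiStar1
  have h1 : q + 2 - 1 = q + 1 := rfl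
  have h2 : q + 1 - 1 = q := rfl
  rw [h1, h2, Finset.sum_Icc_succ_top (by omega)]
  simp only [eval_sub, eval_add, eval_mul, eval_C]
  push_cast
  ring_nf

theorem phi_one (x : ℝ) : (phiStar1 1).eval x = x := by simp [phiStar1]

theorem phi_psi (q m : ℕ) (h : q ≤ m) :
    ∫ x in (0:ℝ)..1, (phiStar1 (q+1)).eval x * (psi (m+1)).eval x = 1 := by
  induction q with
  | zero => simp only [zero_add, phi_one]; exact psi_X m
  | succ q ih =>
    have ih := ih (by omega)
    simp_rw [show q+1+1 = q+2 from rfl, phi_succ, sub_mul, mul_assoc]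
    rw [intervalIntegral.integral_sub, ih, intervalIntegral.integral_const_mul,
      psi_orth q m (by omega)]
    · simp
    all_goals apply Continuous.intervalIntegrable; fun_prop

theorem phi1_norm (q : ℕ) :
    ∫ x in (0:ℝ)..1, (phiStar1 (q+1)).eval x * (phiStar1 (q+1)).eval x
      = 1/(((q:ℝ)+1)*(q+3)) := by
  induction q with
  | zero =>
    simp only [zero_add, phi_one]
    simp_rw [← pow_two]
    rw [integral_pow]; norm_num
  | succ q ih =>
    set a : ℝ := (2*(q:ℝ)+5)/(((q:ℝ)+1)*(q+2)*(q+3)*(q+4)) with ha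
    have e : ∀ x : ℝ, (phiStar1 (q+2)).eval x * (phiStar1 (q+2)).eval x =
      ((phiStar1 (q+1)).eval x * (phiStar1 (q+1)).eval x
        - (2*a) * ((phiStar1 (q+1)).eval x * (psi (q+1)).eval x))
        + a^2 * ((psi (q+1)).eval x * (psi (q+1)).eval x) := by
      intro x; rw [phi_succ]; ring
    simp_rw [show q+1+1 = q+2 from rfl, e]
    rw [intervalIntegral.integral_add, intervalIntegral.integral_sub,
      intervalIntegral.integral_const_mul, intervalIntegral.integral_const_mul,
      ih, phi_psi q q le_rfl, psi_norm, ha]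
    · push_cast
      have : (q:ℝ)+1+3 ≠ 0 := by positivity
      have : (q:ℝ)+1+1 ≠ 0 := by positivity
      field_simp
      ring
    all_goals apply Continuous.intervalIntegrable; fun_prop

theorem g_symm (k : ℕ) (x : ℝ) : (G (k+1)).eval (1-x) = (-1)^k * (G (k+1)).eval x ∧
    (G (k+2)).eval (1-x) = (-1)^(k+1) * (G (k+2)).eval x := by
  induction k with
  | zero => simp [G]; norm_num; ring
  | succ k ih =>
    refine ⟨ih.2, ?_⟩
    have h1 := g_rec (k+1) x
    have h2 := g_rec (k+1) (1-x)
    have e : G (k+1+1) = G (k+2) := rfl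
    rw [e] at h1 h2
    rw [h1, h2, ih.1, ih.2]
    ring

theorem phi2_eq (q : ℕ) (x : ℝ) : (phiStar2 q).eval x = (phiStar1 q).eval (1-x) := by
  unfold phiStar1 phiStar2
  simp only [eval_sub, eval_one, eval_X, eval_finsetSum, eval_mul, eval_C]
  congr 1
  apply Finset.sum_congr rfl
  intro k hk
  obtain ⟨n, rfl⟩ : ∃ n, k = n+1 := ⟨k-1, by simp at hk; omega⟩
  rw [psi_eval, psi_eval, (g_symm n x).1]
  have : n+1-1 = n := rfl
  rw [this]
  ring

/-- ⟨φ₁*,φ₁*⟩ = ⟨φ₂*,φ₂*⟩ = 1/(q(q+2)). -/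
theorem phiStar_norm (q : ℕ) (hq : 1 ≤ q) :
    (∫ x in (0:ℝ)..1, (phiStar1 q).eval x * (phiStar1 q).eval x) = 1/((q:ℝ)*((q:ℝ)+2)) ∧
    (∫ x in (0:ℝ)..1, (phiStar2 q).eval x * (phiStar2 q).eval x) = 1/((q:ℝ)*((q:ℝ)+2)) := by
  obtain ⟨n, rfl⟩ : ∃ n, q = n+1 := ⟨q-1, by omega⟩
  have h := phi1_norm n
  have e : (1:ℝ)/(((n+1:ℕ):ℝ)*(((n+1:ℕ):ℝ)+2)) = 1/(((n:ℝ)+1)*(n+3)) := by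
    push_cast; ring
  rw [e]
  refine ⟨h, ?_⟩
  simp_rw [phi2_eq]
  rw [intervalIntegral.integral_comp_sub_left
    (fun x => (phiStar1 (n+1)).eval x * (phiStar1 (n+1)).eval x) 1]
  simpa using h
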